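/- Let p : ℝⁿ → [0, ∞) be a symmetric decreasing integrable function and q : ℝⁿ → [0, ∞) an integrable Borel measurable function such that ∫_{B^r} q*(x) dx ≤ ∫_{B^r} p(x) dx for every r ≥ 0, where B^r is the ball of radius r centered at the origin and q* is the symmetric decreasing rearrangement of q. Then for every non-negative Borel measurable function h on ℝⁿ vanishing at infinity, ∫_{ℝⁿ} h(x) q(x) dx ≤ ∫_{ℝⁿ} h*(x) p(x) dx, where h* is the symmetric decreasing rearrangement of h and the integrals are understood in [0, ∞]. -/

import Mathlib

open MeasureTheory ENNReal

/-- `fs` is the symmetric decreasing rearrangement of the non-negative function `f` on ℝⁿ: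
for every `t > 0`, the superlevel set `{fs > t}` is an open ball centered at the origin
whose Lebesgue measure equals that of `{f > t}`. -/
def IsSymmDecrRearrangement {n : ℕ}
    (f fs : EuclideanSpace ℝ (Fin n) → ℝ≥0∞) : Prop :=
  ∀ t : ℝ≥0∞, 0 < t → ∃ r : ℝ,
    {x | t < fs x} = Metric.ball (0 : EuclideanSpace ℝ (Fin n)) r ∧
    volume (Metric.ball (0 : EuclideanSpace ℝ (Fin n)) r) = volume {x | t < f x}

/-- A non-negative real function on ℝⁿ is symmetric decreasing if its value depends only on
the Euclidean norm and is non-increasing in the norm. -/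
def SymmetricDecreasing {n : ℕ} (p : EuclideanSpace ℝ (Fin n) → ℝ) : Prop :=
  ∀ x y : EuclideanSpace ℝ (Fin n), ‖x‖ ≤ ‖y‖ → p y ≤ p x

/-- Layer-cake formula for functions with values in `[0, ∞]`. -/
theorem lintegral_eq_lintegral_measure_ofReal_lt {α : Type*} [MeasurableSpace α]
    (μ : Measure α) [SFinite μ] {f : α → ℝ≥0∞} (hf : Measurable f) :
    ∫⁻ x, f x ∂μ = ∫⁻ t in Set.Ioi (0 : ℝ), μ {x | ENNReal.ofReal t < f x} := by
  have hset : MeasurableSet {z : α × ℝ | ENNReal.ofReal z.2 < f z.1} :=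
    measurableSet_lt (by fun_prop) (by fun_prop)
  have hcake (a : ℝ≥0∞) :
      volume.restrict (Set.Ioi (0 : ℝ)) {t | ENNReal.ofReal t < a} = a := by
    rw [Measure.restrict_apply (measurableSet_lt (by fun_prop) (by fun_prop))]
    induction a with
    | top => simp
    | coe a =>
      have : {t : ℝ | ENNReal.ofReal t < a} ∩ Set.Ioi 0 = Set.Ioo 0 (a : ℝ) := by
        ext t
        constructor
        · rintro ⟨h1, h2⟩
          exact ⟨h2, by simpa using (ENNReal.ofReal_lt_iff_lt_toReal (le_of_lt h2) (by simp)).1 h1⟩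
        · rintro ⟨h1, h2⟩
          exact ⟨(ENNReal.ofReal_lt_iff_lt_toReal h1.le (by simp)).2 (by simpa using h2), h1⟩
      rw [this]
      simp
  calc ∫⁻ x, f x ∂μ
      = ∫⁻ x, volume.restrict (Set.Ioi (0 : ℝ)) {t | ENNReal.ofReal t < f x} ∂μ := by
        simp_rw [hcake]
    _ = (μ.prod (volume.restrict (Set.Ioi (0 : ℝ)))) {z | ENNReal.ofReal z.2 < f z.1} :=
        (Measure.prod_apply hset).symm
    _ = _ := Measure.prod_apply_symm hset

theorem IsSymmDecrRearrangement.measurable {n : ℕ}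
    {f fs : EuclideanSpace ℝ (Fin n) → ℝ≥0∞} (hfs : IsSymmDecrRearrangement f fs) :
    Measurable fs := by
  have hpos (t : ℝ≥0∞) (ht : 0 < t) : MeasurableSet {x | t < fs x} := by
    obtain ⟨r, hr, -⟩ := hfs t ht
    exact hr ▸ measurableSet_ball
  refine measurable_of_Ioi fun t => ?_
  rcases eq_or_ne t 0 with rfl | ht
  · have : fs ⁻¹' Set.Ioi 0 = ⋃ k : ℕ, {x | ((k : ℝ≥0∞) + 1)⁻¹ < fs x} := by
      ext x
      simp only [Set.mem_preimage, Set.mem_Ioi, Set.mem_iUnion, Set.mem_ofPred_eq]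
      constructor
      · intro hx
        obtain ⟨k, hk⟩ := ENNReal.exists_inv_nat_lt hx.ne'
        exact ⟨k, lt_of_le_of_lt (ENNReal.inv_le_inv.2 le_self_add) hk⟩
      · rintro ⟨k, hk⟩
        exact bot_lt_of_lt hk
    rw [this]
    exact MeasurableSet.iUnion fun k => hpos _ (by simp)
  · exact hpos t (pos_iff_ne_zero.2 ht)

/-- Among sets of given measure, the integral of `f` is dominated by the integral of its
rearrangement over a centered ball. -/
theorem IsSymmDecrRearrangement.setLIntegral_le {n : ℕ}
    {f fs : EuclideanSpace ℝ (Fin n) → ℝ≥0∞} (hfs : IsSymmDecrRearrangement f fs)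
    (hf : Measurable f) {A : Set (EuclideanSpace ℝ (Fin n))} {r : ℝ}
    (hA : volume A ≤ volume (Metric.ball (0 : EuclideanSpace ℝ (Fin n)) r)) :
    ∫⁻ x in A, f x ≤ ∫⁻ x in Metric.ball (0 : EuclideanSpace ℝ (Fin n)) r, fs x := by
  rw [lintegral_eq_lintegral_measure_ofReal_lt _ hf,
    lintegral_eq_lintegral_measure_ofReal_lt _ hfs.measurable]
  refine setLIntegral_mono' measurableSet_Ioi fun t ht => ?_
  obtain ⟨ρ, hρ, hvol⟩ := hfs (ENNReal.ofReal t) (ENNReal.ofReal_pos.2 ht)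
  rw [Measure.restrict_apply (measurableSet_lt measurable_const hf), hρ,
    Measure.restrict_apply measurableSet_ball]
  rcases le_total ρ r with hle | hle
  · rw [Set.inter_eq_left.2 (Metric.ball_subset_ball hle), hvol]
    exact measure_mono Set.inter_subset_left
  · rw [Set.inter_eq_right.2 (Metric.ball_subset_ball hle)]
    exact (measure_mono Set.inter_subset_right).trans hA

/-- Let `p` be symmetric decreasing and integrable, `q` integrable with
rearrangement `qs` satisfying `∫_{B^r} qs ≤ ∫_{B^r} p` for every ball `B^r` of radius
`r ≥ 0` centered at the origin. Then for every non-negative Borel `h` vanishing at infinity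
with rearrangement `hs`, `∫ h q ≤ ∫ hs p` (integrals in `[0, ∞]`). -/
theorem rearranged_density_domination {n : ℕ}
    (p q : EuclideanSpace ℝ (Fin n) → ℝ)
    (hp0 : ∀ x, 0 ≤ p x) (hq0 : ∀ x, 0 ≤ q x)
    (hpsd : SymmetricDecreasing p) (hpi : Integrable p volume)
    (hqm : Measurable q) (hqi : Integrable q volume)
    (qs : EuclideanSpace ℝ (Fin n) → ℝ≥0∞)
    (hqs : IsSymmDecrRearrangement (fun x => ENNReal.ofReal (q x)) qs)
    (hball : ∀ r : ℝ, 0 ≤ r →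
      ∫⁻ x in Metric.ball (0 : EuclideanSpace ℝ (Fin n)) r, qs x ∂volume
        ≤ ∫⁻ x in Metric.ball (0 : EuclideanSpace ℝ (Fin n)) r,
            ENNReal.ofReal (p x) ∂volume)
    (h hs : EuclideanSpace ℝ (Fin n) → ℝ≥0∞) (hhm : Measurable h)
    (hhv : ∀ t : ℝ≥0∞, 0 < t → volume {x | t < h x} < ∞)
    (hhs : IsSymmDecrRearrangement h hs) :
    ∫⁻ x, h x * ENNReal.ofReal (q x) ∂volume
      ≤ ∫⁻ x, hs x * ENNReal.ofReal (p x) ∂volume := by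
  have hqm' : Measurable fun x => ENNReal.ofReal (q x) := hqm.ennreal_ofReal
  have hpm' : AEMeasurable (fun x => ENNReal.ofReal (p x)) volume :=
    hpi.aestronglyMeasurable.aemeasurable.ennreal_ofReal
  have hweight {w g : EuclideanSpace ℝ (Fin n) → ℝ≥0∞} (hw : AEMeasurable w volume)
      (hg : Measurable g) : ∫⁻ x, g x * w x =
        ∫⁻ t in Set.Ioi (0 : ℝ), ∫⁻ x in {x | ENNReal.ofReal t < g x}, w x := by
    have hdens : ∫⁻ x, g x * w x = ∫⁻ x, g x ∂(volume.withDensity w) := by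
      rw [lintegral_withDensity_eq_lintegral_mul₀ hw hg.aemeasurable]
      simp [mul_comm]
    rw [hdens, lintegral_eq_lintegral_measure_ofReal_lt _ hg]
    exact lintegral_congr fun t => withDensity_apply _ (measurableSet_lt measurable_const hg)
  rw [hweight hqm'.aemeasurable hhm, hweight hpm' hhs.measurable]
  refine setLIntegral_mono' measurableSet_Ioi fun t ht => ?_
  obtain ⟨r, hr, hvol⟩ := hhs (ENNReal.ofReal t) (ENNReal.ofReal_pos.2 ht)
  rw [hr]
  refine (hqs.setLIntegral_le hqm' hvol.ge).trans ?_
  rcases le_total 0 r with h0 | h0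
  · exact hball r h0
  · simp [Metric.ball_eq_empty.2 h0]
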